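/- Let ω ∈ T2.3 with n = |ω|, so f_k < n < f_{k+1}, sk(ω) = s_{k-2}, and ω = s_{k-1}[f_{k+1}−n−i, f_{k-1}] · s_{k-2} · s_{k-1}[1, f_{k-1}−i−1] for some 0 ≤ i ≤ f_{k+1}−n−2. Then both gaps of ω are overlaps: ν_{ω,1}^{-1} = s_{k-1}[f_{k+1}−n−i, f_{k-1}−i−1] with |ν_{ω,1}| = f_k − n < 0, and ν_{ω,2}^{-1} = F_k[f_{k+1}−n−i−1, f_k−i−2] with |ν_{ω,2}| = f_{k-1} − n < 0; i.e., every pair of consecutive occurrences of ω in F_∞ overlaps, in the word s_{k-1}[f_{k+1}−n−i, f_{k-1}−i−1] of length n−f_k or in the word F_k[f_{k+1}−n−i−1, f_k−i−2] of length n−f_{k-1} respectively. -/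

import Mathlib

/-- Finite Fibonacci words: `Fw k = σ^k(a)` where `a = false`, `b = true`,
`σ(a) = ab`, `σ(b) = a`; so `Fw (k+2) = Fw (k+1) ++ Fw k`. -/
def Fw : ℕ → List Bool
  | 0 => [false]
  | 1 => [false, true]
  | (k+2) => Fw (k+1) ++ Fw k

/-- The infinite Fibonacci word `F_∞` (0-indexed): since `Fw (n+1)` has length
`fib (n+3) > n`, its `n`-th letter is the `n`-th letter of `F_∞`. -/
def fw (n : ℕ) : Bool := (Fw (n+1)).getD n false

/-- Singular words, with index shifted by one: `sw n = s_{n-1}`.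
`sw 0 = s_{-1} = a`, and `sw (n+1) = s_n = β_n · F_n · α_n⁻¹` where
`α_n` is the last letter of `F_n` and `β_n` the other letter. -/
def sw : ℕ → List Bool
  | 0 => [false]
  | (n+1) => (!((Fw n).getLastD false)) :: (Fw n).dropLast

/-- The factor of `F_∞` of length `n` starting at (0-indexed) position `i`. -/
def seg (i n : ℕ) : List Bool := (List.range n).map (fun t => fw (i + t))

/-- `w` occurs in `F_∞` at (0-indexed) position `i`. -/
def OccursAt (w : List Bool) (i : ℕ) : Prop := seg i w.length = w

/-- `w` is a factor of `F_∞`. -/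
def IsFactor (w : List Bool) : Prop := ∃ i, OccursAt w i

/-- Starting position of the `(p+1)`-st occurrence of `w` in `F_∞`
(occurrences enumerated by starting position, 0-indexed: `occPos w 0`
is the first occurrence, i.e. the paper's `ω_1`). -/
noncomputable def occPos (w : List Bool) (p : ℕ) : ℕ := Nat.nth (OccursAt w) p

/-- A finite word viewed as an element of the free group on the alphabet. -/
def listToFree (w : List Bool) : FreeGroup Bool := (w.map FreeGroup.of).prod

/-- The gap `ν_{w,p}` (0-indexed in `p`: `gap w 0` is the paper's `ν_{w,1}`)
between the `(p+1)`-st and `(p+2)`-nd occurrences of `w`, as an element of the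
free group: the separating word if the occurrences are separated or adjacent,
and the formal inverse of the overlap if they overlap. -/
noncomputable def gap (w : List Bool) (p : ℕ) : FreeGroup Bool :=
  if occPos w p + w.length ≤ occPos w (p+1) then
    listToFree (seg (occPos w p + w.length) (occPos w (p+1) - (occPos w p + w.length)))
  else
    (listToFree (seg (occPos w (p+1)) (occPos w p + w.length - occPos w (p+1))))⁻¹

/-- The signed length `|ν_{w,p}|` of the gap (negative in the overlapped case). -/
noncomputable def gapLen (w : List Bool) (p : ℕ) : ℤ :=
  (occPos w (p+1) : ℤ) - ((occPos w p : ℤ) + (w.length : ℤ))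

/-- `u` is a singular word (some `s_k`, `k ≥ -1`). -/
def IsSingular (u : List Bool) : Prop := ∃ n, u = sw n

/-- `u` is a singular kernel of `w`: a singular factor of `w` of maximal length. -/
def IsKernelOf (u w : List Bool) : Prop :=
  IsSingular u ∧ u <:+: w ∧ ∀ v : List Bool, IsSingular v → v <:+: w → v.length ≤ u.length

/-- The excluded words `{ε, ab, ba, aba}`. -/
def excl : List (List Bool) := [[], [false, true], [true, false], [false, true, false]]

/-- The `i`-th conjugate `C_i(w)` (indices taken mod the length). -/
def conj (i : ℕ) (w : List Bool) : List Bool :=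
  w.drop (i % w.length) ++ w.take (i % w.length)

/-- `sliceW u i j = u[i,j]`, the letters `i` through `j` of `u`, 1-indexed. -/
def sliceW (u : List Bool) (i j : ℕ) : List Bool := (u.take j).drop (i - 1)

theorem length_Fw : ∀ k, (Fw k).length = Nat.fib (k + 2)
  | 0 => rfl
  | 1 => rfl
  | k + 2 => by
    rw [Fw, List.length_append, length_Fw (k + 1), length_Fw k, Nat.fib_add_two (n := k + 2)]
    ring

theorem Fw_prefix_succ (k : ℕ) : Fw k <+: Fw (k + 1) := by
  cases k with
  | zero => exact ⟨[true], rfl⟩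
  | succ k => exact ⟨Fw k, rfl⟩

theorem Fw_prefix {k l : ℕ} (h : k ≤ l) : Fw k <+: Fw l := by
  induction h with
  | refl => exact List.prefix_rfl
  | step _ ih => exact ih.trans (Fw_prefix_succ _)

theorem lt_fib_add_three (n : ℕ) : n < Nat.fib (n + 3) := by
  induction n with
  | zero => decide
  | succ n ih =>
    have h := Nat.fib_add_two (n := n + 2)
    have := Nat.fib_pos.2 (show 0 < n + 2 by omega)
    have e : n + 1 + 3 = n + 2 + 2 := by ring
    rw [e, h]
    have e2 : n + 2 + 1 = n + 3 := by ring
    rw [e2]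
    omega

/-- Every finite Fibonacci word is a prefix of the infinite one. -/
theorem Fw_getElem? {k t : ℕ} (h : t < Nat.fib (k + 2)) : (Fw k)[t]? = some (fw t) := by
  have h1 : t < (Fw k).length := by rwa [length_Fw]
  have h2 : t < (Fw (t + 1)).length := by rw [length_Fw]; exact lt_fib_add_three t
  have key : (Fw k)[t]? = (Fw (t + 1))[t]? := by
    rcases le_total k (t + 1) with hk | hk
    · obtain ⟨s, hs⟩ := Fw_prefix hk
      rw [← hs, List.getElem?_append_left h1]
    · obtain ⟨s, hs⟩ := Fw_prefix hk
      rw [← hs, List.getElem?_append_left h2]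
  rw [key, fw, List.getD_eq_getElem?_getD, List.getElem?_eq_getElem h2]
  rfl

theorem fw_fib_add {k t : ℕ} (h : t < Nat.fib (k + 2)) : fw (Nat.fib (k + 3) + t) = fw t := by
  have h1 := Nat.fib_add_two (n := k + 2)
  have h2 : (Fw (k + 2))[Nat.fib (k + 3) + t]? = some (fw (Nat.fib (k + 3) + t)) :=
    Fw_getElem? (by rw [h1, add_comm (Nat.fib (k + 2))]; exact Nat.add_lt_add_left h _)
  have hl : (Fw (k + 1)).length = Nat.fib (k + 3) := length_Fw (k + 1)
  rw [Fw, List.getElem?_append_right (by omega), hl, Nat.add_sub_cancel_left, Fw_getElem? h] at h2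
  exact (Option.some.inj h2).symm

/-- The substitution `a ↦ ab`, `b ↦ a` on letters. -/
def fibSubst (x : Bool) : List Bool := if x then [false] else [false, true]

theorem Fw_succ_eq_flatMap : ∀ k, Fw (k + 1) = (Fw k).flatMap fibSubst
  | 0 => rfl
  | 1 => rfl
  | k + 2 => by
    have e : Fw (k + 2 + 1) = Fw (k + 2) ++ Fw (k + 1) := rfl
    have e' : Fw (k + 2) = Fw (k + 1) ++ Fw k := rfl
    rw [e, e', List.flatMap_append, ← Fw_succ_eq_flatMap (k + 1), ← Fw_succ_eq_flatMap k]
    rfl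

/-- Starting position of the image of the `p`-th letter in the decomposition of the Fibonacci
word into the images of its letters under the `k`-th power of the substitution. -/
def blockPos (k p : ℕ) : ℕ :=
  ∑ t ∈ Finset.range p, if fw t then Nat.fib (k + 1) else Nat.fib (k + 2)

theorem blockPos_zero (k : ℕ) : blockPos k 0 = 0 := rfl

theorem blockPos_succ_of_false {k p : ℕ} (h : fw p = false) :
    blockPos k (p + 1) = blockPos k p + Nat.fib (k + 2) := by
  simp [blockPos, Finset.sum_range_succ, h]

theorem blockPos_succ_of_true {k p : ℕ} (h : fw p = true) :
    blockPos k (p + 1) = blockPos k p + Nat.fib (k + 1) := by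
  simp [blockPos, Finset.sum_range_succ, h]

theorem blockPos_strictMono (k : ℕ) : StrictMono (blockPos k) := by
  refine strictMono_nat_of_lt_succ fun p => ?_
  have h1 := Nat.fib_pos.2 (show 0 < k + 1 by omega)
  have h2 := Nat.fib_pos.2 (show 0 < k + 2 by omega)
  cases h : fw p
  · rw [blockPos_succ_of_false h]; omega
  · rw [blockPos_succ_of_true h]; omega

theorem length_flatMap_take {k p : ℕ} (h : p ≤ Nat.fib (k + 2)) :
    (((Fw k).take p).flatMap fibSubst).length = blockPos 1 p := by
  induction p with
  | zero => simp [blockPos]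
  | succ p ih =>
    have hp : p < Nat.fib (k + 2) := h
    rw [List.take_add_one, Fw_getElem? hp, List.flatMap_append, List.length_append, ih hp.le]
    cases hf : fw p
    · rw [blockPos_succ_of_false hf]; rfl
    · rw [blockPos_succ_of_true hf]; rfl

/-- The Fibonacci word is fixed by the substitution. -/
theorem fw_blockPos_one_add {p t : ℕ} (h : t < (fibSubst (fw p)).length) :
    (fibSubst (fw p))[t]? = some (fw (blockPos 1 p + t)) := by
  have hp : p < Nat.fib (p + 1 + 2) := lt_fib_add_three p
  have hlen := length_flatMap_take hp.le
  have hpl : p < (Fw (p + 1)).length := by rwa [length_Fw]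
  have hget : (Fw (p + 1))[p] = fw p :=
    Option.some.inj ((List.getElem?_eq_getElem hpl).symm.trans (Fw_getElem? hp))
  have hsplit : Fw (p + 2) = ((Fw (p + 1)).take p).flatMap fibSubst ++
      (fibSubst (fw p) ++ ((Fw (p + 1)).drop (p + 1)).flatMap fibSubst) := by
    rw [Fw_succ_eq_flatMap (p + 1), ← hget, ← List.flatMap_cons, ← List.flatMap_append,
      List.getElem_cons_drop, List.take_append_drop]
  have hlt : blockPos 1 p + t < Nat.fib (p + 2 + 2) := by
    rw [← length_Fw, hsplit, List.length_append, List.length_append, hlen]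
    omega
  have := Fw_getElem? hlt
  rwa [hsplit, List.getElem?_append_right (by omega), hlen, Nat.add_sub_cancel_left,
    List.getElem?_append_left h] at this

theorem fw_blockPos_one (p : ℕ) : fw (blockPos 1 p) = false := by
  have := fw_blockPos_one_add (p := p) (t := 0)
  cases h : fw p <;> simpa [h, fibSubst] using this

theorem fw_blockPos_one_add_one {p : ℕ} (h : fw p = false) : fw (blockPos 1 p + 1) = true := by
  have := fw_blockPos_one_add (p := p) (t := 1)
  simpa [h, fibSubst] using this

theorem blockPos_succ_left (k p : ℕ) : blockPos (k + 1) p = blockPos k (blockPos 1 p) := by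
  induction p with
  | zero => rfl
  | succ p ih =>
    have h0 := fw_blockPos_one p
    cases h : fw p
    · have h1 := fw_blockPos_one_add_one h
      have e : blockPos 1 (p + 1) = blockPos 1 p + 1 + 1 := blockPos_succ_of_false h
      rw [blockPos_succ_of_false h, e, blockPos_succ_of_true h1, blockPos_succ_of_false h0, ih]
      have e2 : Nat.fib (k + 1 + 2) = Nat.fib (k + 1) + Nat.fib (k + 2) := Nat.fib_add_two
      omega
    · have e : blockPos 1 (p + 1) = blockPos 1 p + 1 := blockPos_succ_of_true h
      rw [blockPos_succ_of_true h, e, blockPos_succ_of_false h0, ih]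

/-- The prefix of length `f_{k+1} - 2` occurs at the start of every block. -/
theorem fw_blockPos_add {k : ℕ} (hk : 2 ≤ k) :
    ∀ {p t : ℕ}, t + 2 < Nat.fib (k + 3) → fw (blockPos k p + t) = fw t := by
  induction k, hk using Nat.le_induction with
  | base =>
    intro p t ht
    have ht' : t + 2 < 5 := ht
    have h0 := fw_blockPos_one p
    have e : blockPos 2 p = blockPos 1 (blockPos 1 p) := blockPos_succ_left 1 p
    have e1 : blockPos 1 (blockPos 1 p + 1) = blockPos 1 (blockPos 1 p) + 2 :=
      blockPos_succ_of_false h0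
    have t0 : t = 0 ∨ t = 1 ∨ t = 2 := by omega
    rcases t0 with rfl | rfl | rfl
    · rw [e]; exact fw_blockPos_one _
    · rw [e]; exact fw_blockPos_one_add_one h0
    · rw [e, ← e1]; exact fw_blockPos_one _
  | succ k hk ih =>
    intro p t ht
    have f1 : Nat.fib (k + 3) = Nat.fib (k + 1) + Nat.fib (k + 2) := Nat.fib_add_two
    have f2 : Nat.fib (k + 1 + 3) = Nat.fib (k + 2) + Nat.fib (k + 3) := Nat.fib_add_two
    have f3 : 2 ≤ Nat.fib (k + 1) := Nat.fib_mono (show 3 ≤ k + 1 by omega)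
    by_cases hs : t + 2 < Nat.fib (k + 3)
    · rw [blockPos_succ_left]; exact ih hs
    · have key : ∀ p, fw (blockPos (k + 1) p + t) = fw (t - Nat.fib (k + 2)) := by
        intro p
        rw [← ih (p := blockPos 1 p + 1) (t := t - Nat.fib (k + 2)) (by omega),
          blockPos_succ_of_false (fw_blockPos_one p), blockPos_succ_left]
        congr 1; omega
      have := key 0
      rw [blockPos_zero, zero_add] at this
      rw [key p, this]

theorem fw_zero : fw 0 = false := rfl

theorem fw_one : fw 1 = true := rfl

theorem blockPos_one (k : ℕ) : blockPos k 1 = Nat.fib (k + 2) := by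
  rw [← zero_add 1, blockPos_succ_of_false fw_zero, blockPos_zero, zero_add]

/-- The prefix of length `f_k + f_{k+1} - 2` has period `f_k`. -/
theorem fw_fib_add' {k t : ℕ} (hk : 2 ≤ k) (h : t + 2 < Nat.fib (k + 3)) :
    fw (Nat.fib (k + 2) + t) = fw t := by
  rw [← blockPos_one]; exact fw_blockPos_add hk h

theorem fw_fib_sub_one : ∀ m, fw (Nat.fib (m + 2) - 1) = decide (m % 2 = 1)
  | 0 => rfl
  | 1 => rfl
  | m + 2 => by
    have h1 : Nat.fib (m + 2 + 2) = Nat.fib (m + 2) + Nat.fib (m + 3) := Nat.fib_add_two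
    have h2 := Nat.fib_pos.2 (show 0 < m + 2 by omega)
    have e : Nat.fib (m + 2 + 2) - 1 = Nat.fib (m + 3) + (Nat.fib (m + 2) - 1) := by omega
    rw [e, fw_fib_add (by omega), fw_fib_sub_one m, Nat.add_mod_right]

theorem fw_fib_sub_two : ∀ m, fw (Nat.fib (m + 3) - 2) = decide (m % 2 = 1)
  | 0 => rfl
  | 1 => rfl
  | m + 2 => by
    have h1 : Nat.fib (m + 2 + 3) = Nat.fib (m + 3) + Nat.fib (m + 4) := Nat.fib_add_two
    have h2 : 2 ≤ Nat.fib (m + 3) := Nat.fib_mono (show 3 ≤ m + 3 by omega)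
    have e : Nat.fib (m + 2 + 3) - 2 = Nat.fib (m + 1 + 3) + (Nat.fib (m + 3) - 2) := by
      rw [h1, add_comm, Nat.add_sub_assoc h2]
    have h3 : Nat.fib (m + 3) - 2 < Nat.fib (m + 1 + 2) :=
      Nat.sub_lt (by omega) two_pos
    rw [e, fw_fib_add h3, fw_fib_sub_two m, Nat.add_mod_right]

theorem sum_fw (k : ℕ) : ∑ t ∈ Finset.range (Nat.fib (k + 2)), (fw t).toNat = Nat.fib k := by
  induction k using Nat.strong_induction_on with
  | _ k ih =>
    match k with
    | 0 => rfl
    | 1 => rfl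
    | k + 2 =>
      have h1 : Nat.fib (k + 2 + 2) = Nat.fib (k + 3) + Nat.fib (k + 2) :=
        Nat.fib_add_two.trans (add_comm _ _)
      have hs : ∑ t ∈ Finset.range (Nat.fib (k + 2)), (fw (Nat.fib (k + 3) + t)).toNat =
          ∑ t ∈ Finset.range (Nat.fib (k + 2)), (fw t).toNat :=
        Finset.sum_congr rfl fun t ht => by rw [fw_fib_add (Finset.mem_range.1 ht)]
      rw [h1, Finset.sum_range_add, hs, ih (k + 1) (by omega), ih k (by omega), Nat.fib_add_two,
        add_comm]

theorem sum_range_add_of_periodic {g : ℕ → ℕ} {f : ℕ} (hg : Function.Periodic g f) (j : ℕ) :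
    ∑ t ∈ Finset.range f, g (j + t) = ∑ t ∈ Finset.range f, g t := by
  induction j with
  | zero => simp
  | succ j ih =>
    rw [← ih]
    have h1 := Finset.sum_range_succ (fun t => g (j + t)) f
    have h2 := Finset.sum_range_succ' (fun t => g (j + t)) f
    have h3 : g (j + f) = g j := hg j
    have h4 : ∀ t, g (j + 1 + t) = g (j + (t + 1)) := fun t => by congr 1; ring
    simp only [h4]
    simp only [add_zero] at h2
    omega

theorem sum_range_mul_of_periodic {g : ℕ → ℕ} {e : ℕ} (hg : Function.Periodic g e) (m : ℕ) :
    ∑ t ∈ Finset.range (e * m), g t = m * ∑ t ∈ Finset.range e, g t := by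
  induction m with
  | zero => simp
  | succ m ih =>
    rw [Nat.mul_succ, Finset.sum_range_add, ih, sum_range_add_of_periodic hg]
    ring

/-- A periodic sequence whose sum over a period `f` is coprime to `f` has no smaller period. -/
theorem dvd_of_periodic_of_coprime {g : ℕ → ℕ} {f d : ℕ} (hf : 0 < f)
    (hg : Function.Periodic g f) (hd : Function.Periodic g d)
    (hc : Nat.Coprime f (∑ t ∈ Finset.range f, g t)) : f ∣ d := by
  have he : Function.Periodic g (d.gcd f) := by
    rcases Nat.eq_zero_or_pos d with rfl | hd0
    · simpa using hg
    rcases (Nat.le_of_dvd hf (Nat.gcd_dvd_right d f)).lt_or_eq with hlt | heq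
    · obtain ⟨x, -, hx⟩ := Nat.exists_mul_mod_eq_gcd hlt
      intro y
      have h1 : g (y + d * x) = g y := by
        have := hd.nat_mul x y
        rwa [Nat.cast_id, mul_comm] at this
      have h2 := hg.nat_mul (d * x / f) (y + d.gcd f)
      have h3 : y + d.gcd f + ((d * x / f : ℕ) : ℕ) * f = y + d * x := by
        have := Nat.mod_add_div (d * x) f
        rw [hx] at this
        rw [mul_comm (d * x / f) f, add_assoc, this]
      rw [Nat.cast_id, h3, h1] at h2
      exact h2.symm
    · rwa [heq]
  obtain ⟨m, hm⟩ := Nat.gcd_dvd_right d f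
  have hs := sum_range_mul_of_periodic he m
  rw [← hm] at hs
  have hm1 : m = 1 := Nat.eq_one_of_dvd_coprimes hc ⟨_, by rw [mul_comm]; exact hm⟩ ⟨_, hs⟩
  rw [hm1, mul_one] at hm
  rw [hm]
  exact Nat.gcd_dvd_left d f

theorem coprime_fib_add_two (k : ℕ) : Nat.Coprime (Nat.fib (k + 2)) (Nat.fib k) := by
  rw [Nat.fib_add_two]
  simpa using (Nat.fib_coprime_fib_succ k).symm

/-- Periodic continuation of the word `F_k`. -/
def fwMod (k x : ℕ) : ℕ := (fw (x % Nat.fib (k + 2))).toNat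

theorem fwMod_periodic (k : ℕ) : Function.Periodic (fwMod k) (Nat.fib (k + 2)) := fun x => by
  simp [fwMod]

theorem sum_fwMod (k : ℕ) : ∑ t ∈ Finset.range (Nat.fib (k + 2)), fwMod k t = Nat.fib k := by
  rw [← sum_fw k]
  exact Finset.sum_congr rfl fun t ht => by
    rw [fwMod, Nat.mod_eq_of_lt (Finset.mem_range.1 ht)]

/-- The conjugates of `F_k` are pairwise distinct. -/
theorem eq_of_fwMod_eq {k i j : ℕ} (hi : i < Nat.fib (k + 2)) (hj : j < Nat.fib (k + 2))
    (h : ∀ t < Nat.fib (k + 2), fwMod k (i + t) = fwMod k (j + t)) : i = j := by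
  wlog hij : i ≤ j generalizing i j
  · exact (this hj hi (fun t ht => (h t ht).symm) (le_of_not_ge hij)).symm
  have hf := Nat.fib_pos.2 (show 0 < k + 2 by omega)
  have hall : ∀ t, fwMod k (i + t) = fwMod k (j + t) := fun t => by
    have := h (t % Nat.fib (k + 2)) (Nat.mod_lt _ hf)
    simpa [fwMod, Nat.add_mod] using this
  have hd : Function.Periodic (fwMod k) (j - i) := fun x => by
    have h1 := hall (x + (Nat.fib (k + 2) - i))
    have e1 : i + (x + (Nat.fib (k + 2) - i)) = x + Nat.fib (k + 2) := by omega
    have e2 : j + (x + (Nat.fib (k + 2) - i)) = x + (j - i) + Nat.fib (k + 2) := by omega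
    rw [e1, e2, fwMod_periodic k, fwMod_periodic k] at h1
    exact h1.symm
  have hdvd := dvd_of_periodic_of_coprime hf (fwMod_periodic k) hd
    (by rw [sum_fwMod]; exact coprime_fib_add_two k)
  have := Nat.eq_zero_of_dvd_of_lt hdvd (by omega)
  omega

theorem exists_blockPos_add (k q : ℕ) :
    ∃ p j, q = blockPos k p + j ∧ q < blockPos k (p + 1) := by
  induction q with
  | zero => exact ⟨0, 0, rfl, by simpa [blockPos_zero] using blockPos_strictMono k zero_lt_one⟩
  | succ q ih =>
    obtain ⟨p, j, hq, hlt⟩ := ih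
    rcases (Nat.succ_le_of_lt hlt).lt_or_eq with h | h
    · exact ⟨p, j + 1, by omega, h⟩
    · exact ⟨p + 1, 0, h, by rw [← Nat.succ_eq_add_one, h]; exact blockPos_strictMono k (by omega)⟩

/-- A factor of length `f_k` at a position `j ≤ f_{k-1} - 3` occurs only at distance `j` from the
start of a block. -/
theorem exists_eq_blockPos_add {k j q : ℕ} (hk : 2 ≤ k) (hj : j + 2 < Nat.fib (k + 1))
    (h : ∀ t < Nat.fib (k + 2), fw (q + t) = fw (j + t)) : ∃ p, q = blockPos k p + j := by
  have f1 : Nat.fib (k + 3) = Nat.fib (k + 1) + Nat.fib (k + 2) := Nat.fib_add_two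
  have f2 : Nat.fib (k + 2) = Nat.fib k + Nat.fib (k + 1) := Nat.fib_add_two
  have hper : ∀ t, t + 2 < Nat.fib (k + 3) → fwMod k t = (fw t).toNat := fun t ht => by
    rcases lt_or_ge t (Nat.fib (k + 2)) with hlt | hge
    · rw [fwMod, Nat.mod_eq_of_lt hlt]
    · obtain ⟨s, rfl⟩ := Nat.exists_eq_add_of_le hge
      have hs : s < Nat.fib (k + 2) := by
        have := Nat.fib_mono (show k + 1 ≤ k + 2 by omega)
        omega
      rw [fw_fib_add' hk (by omega), fwMod, Nat.add_mod_left, Nat.mod_eq_of_lt hs]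
  have hwin : ∀ t < Nat.fib (k + 2), (fw (q + t)).toNat = fwMod k (j + t) := fun t ht => by
    rw [h t ht, hper _ (by omega)]
  obtain ⟨p, j', rfl, hlt⟩ := exists_blockPos_add k q
  refine ⟨p, ?_⟩
  congr 1
  cases hp : fw p
  · have hs := blockPos_succ_of_false (k := k) hp
    refine eq_of_fwMod_eq (k := k) (by omega) (by omega) fun t ht => ?_
    rw [← hwin t ht]
    rcases lt_or_ge (j' + t) (Nat.fib (k + 2)) with hl | hge
    · rw [add_assoc, fw_blockPos_add hk (by omega), hper _ (by omega)]
    · obtain ⟨s, hs'⟩ := Nat.exists_eq_add_of_le hge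
      rw [add_assoc, hs', ← add_assoc, ← hs, fw_blockPos_add hk (by omega), fwMod,
        Nat.add_mod_left, Nat.mod_eq_of_lt (by omega)]
  · have hs := blockPos_succ_of_true (k := k) hp
    have hinit : ∀ t, j' + t + 2 < Nat.fib (k + 3) →
        (fw (blockPos k p + j' + t)).toNat = fwMod k (j' + t) := fun t ht => by
      rw [add_assoc, fw_blockPos_add hk ht, hper _ ht]
    rcases lt_or_ge (j' + 1) (Nat.fib (k + 1)) with hl | hge
    · refine eq_of_fwMod_eq (k := k) (by omega) (by omega) fun t ht => ?_
      rw [← hwin t ht, hinit t (by omega)]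
    · exfalso
      have hj' : j' + 1 = Nat.fib (k + 1) := by omega
      obtain ⟨m, hm⟩ : ∃ m, Nat.fib (k + 2) = m + 1 := ⟨Nat.fib (k + 2) - 1, by omega⟩
      have hsum := (sum_range_add_of_periodic (fwMod_periodic k) j).trans
        (sum_range_add_of_periodic (fwMod_periodic k) j').symm
      rw [hm, Finset.sum_range_succ, Finset.sum_range_succ,
        Finset.sum_congr rfl fun t ht => (hwin t (by have := Finset.mem_range.1 ht; omega)).symm,
        Finset.sum_congr rfl fun t ht => hinit t (by have := Finset.mem_range.1 ht; omega),
        ← hwin m (by omega)] at hsum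
      have hlast := Nat.add_left_cancel hsum
      have e1 : blockPos k p + j' + m = blockPos k (p + 1) + (Nat.fib (k + 2) - 2) := by omega
      have e2 : j' + m = Nat.fib (k + 1) - 2 + Nat.fib (k + 2) := by omega
      rw [e1, fw_blockPos_add hk (by omega), e2, fwMod_periodic k, fwMod,
        Nat.mod_eq_of_lt (by omega)] at hlast
      obtain ⟨l, rfl⟩ := Nat.exists_eq_add_of_le' hk
      have g1 := fw_fib_sub_two (l + 1)
      have g2 := fw_fib_sub_two l
      have e3 : l + 1 + 3 = l + 2 + 2 := by ring
      have e4 : l + 3 = l + 2 + 1 := by ring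
      rw [e3] at g1
      rw [e4] at g2
      rw [g1, g2] at hlast
      rcases Nat.mod_two_eq_zero_or_one l with h0 | h0 <;> simp [Nat.add_mod, h0] at hlast

theorem seg_getElem? (i n t : ℕ) : (seg i n)[t]? = if t < n then some (fw (i + t)) else none := by
  rw [seg, List.getElem?_map]
  split_ifs with h
  · rw [List.getElem?_range h]; rfl
  · rw [List.getElem?_eq_none (by simpa using h)]; rfl

theorem length_seg (i n : ℕ) : (seg i n).length = n := by simp [seg]

theorem seg_eq_seg_iff {i j n : ℕ} : seg i n = seg j n ↔ ∀ t < n, fw (i + t) = fw (j + t) := by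
  simp [seg]

theorem seg_add (i m n : ℕ) : seg i (m + n) = seg i m ++ seg (i + m) n := by
  simp [seg, List.range_add, Function.comp_def, add_assoc]

/-- Occurrences of a factor of the prefix of length `f_{k+1} - 2` that is longer than `f_k`. -/
theorem occPos_seg {k j n : ℕ} (hk : 2 ≤ k) (hn : Nat.fib (k + 2) < n)
    (hj : j + n + 2 ≤ Nat.fib (k + 3)) (p : ℕ) : occPos (seg j n) p = blockPos k p + j := by
  have f1 : Nat.fib (k + 3) = Nat.fib (k + 1) + Nat.fib (k + 2) := Nat.fib_add_two
  have hocc : ∀ q, OccursAt (seg j n) q ↔ ∃ p, blockPos k p + j = q := fun q => by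
    rw [OccursAt, length_seg, seg_eq_seg_iff]
    constructor
    · intro h
      obtain ⟨p, hp⟩ := exists_eq_blockPos_add hk (by omega) fun t ht => h t (ht.trans hn)
      exact ⟨p, hp.symm⟩
    · rintro ⟨p, rfl⟩ t ht
      rw [add_assoc, fw_blockPos_add hk (by omega)]
  have hmono : StrictMono fun p => blockPos k p + j :=
    fun a b hab => Nat.add_lt_add_right (blockPos_strictMono k hab) j
  have := Nat.nth_comp_of_strictMono (p := OccursAt (seg j n)) (n := p) hmono
    (fun q hq => (hocc q).1 hq) ?_
  · rw [occPos, ← this]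
    have ht : (fun i => OccursAt (seg j n) (blockPos k i + j)) = fun _ => True :=
      funext fun i => eq_true ((hocc _).2 ⟨i, rfl⟩)
    simp [ht, Nat.nth_true]
  · intro hfin
    refine absurd hfin (Set.infinite_of_injective_forall_mem hmono.injective fun p => ?_)
    exact (hocc _).2 ⟨p, rfl⟩

theorem take_seg {i m n : ℕ} (h : m ≤ n) : (seg i n).take m = seg i m := by
  obtain ⟨d, rfl⟩ := Nat.exists_eq_add_of_le h
  rw [seg_add, List.take_append_of_le_length (length_seg i m).ge,
    List.take_of_length_le (length_seg i m).le]

theorem drop_seg {i m n : ℕ} (h : m ≤ n) : (seg i n).drop m = seg (i + m) (n - m) := by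
  obtain ⟨d, rfl⟩ := Nat.exists_eq_add_of_le h
  rw [seg_add, List.drop_left' (length_seg i m), Nat.add_sub_cancel_left]

theorem Fw_eq_seg (k : ℕ) : Fw k = seg 0 (Nat.fib (k + 2)) := by
  refine List.ext_getElem? fun t => ?_
  rw [seg_getElem?]
  split_ifs with h
  · rw [Fw_getElem? h, zero_add]
  · exact List.getElem?_eq_none (by rw [length_Fw]; omega)

theorem sw_succ_eq (k : ℕ) :
    sw (k + 1) = (!fw (Nat.fib (k + 2) - 1)) :: seg 0 (Nat.fib (k + 2) - 1) := by
  have hpos := Nat.fib_pos.2 (show 0 < k + 2 by omega)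
  obtain ⟨m, hm⟩ : ∃ m, Nat.fib (k + 2) = m + 1 := ⟨Nat.fib (k + 2) - 1, by omega⟩
  have hF : Fw k = seg 0 m ++ [fw m] := by
    rw [Fw_eq_seg, hm, seg_add]; simp [seg]
  rw [sw, hF, hm]
  simp

theorem sliceW_sw_succ {k a b : ℕ} (hab : a < b) (hb : b ≤ Nat.fib (k + 2)) :
    sliceW (sw (k + 1)) (a + 2) b = seg a (b - 1 - a) := by
  obtain ⟨c, rfl⟩ := Nat.exists_eq_add_of_lt hab
  rw [sliceW, sw_succ_eq, List.take_succ_cons, take_seg (by omega)]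
  change (seg 0 (a + c)).drop a = _
  rw [drop_seg (by omega), zero_add, Nat.add_sub_cancel]

theorem sliceW_sw_succ_one {k b : ℕ} (h0 : 0 < b) (hb : b ≤ Nat.fib (k + 2)) :
    sliceW (sw (k + 1)) 1 b = (!fw (Nat.fib (k + 2) - 1)) :: seg 0 (b - 1) := by
  obtain ⟨c, rfl⟩ := Nat.exists_eq_add_of_lt h0
  rw [sliceW, sw_succ_eq, List.take_succ_cons, take_seg (by omega)]
  simp

/-- Prefixes of the singular word `s_m` occur one letter before position `f_{m+1}`. -/
theorem not_fw_cons_seg {m n : ℕ} (hm : 1 ≤ m) (hn : n + 2 ≤ Nat.fib (m + 4)) :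
    (!fw (Nat.fib (m + 2) - 1)) :: seg 0 n = seg (Nat.fib (m + 3) - 1) (n + 1) := by
  have hpos := Nat.fib_pos.2 (show 0 < m + 3 by omega)
  rw [add_comm n 1, seg_add, Nat.sub_add_cancel hpos]
  have h1 : seg 0 n = seg (Nat.fib (m + 3)) n := seg_eq_seg_iff.2 fun t ht => by
    rw [zero_add]
    exact (fw_fib_add' (k := m + 1) (by omega) (show t + 2 < Nat.fib (m + 4) by omega)).symm
  have h2 : fw (Nat.fib (m + 3) - 1) = !fw (Nat.fib (m + 2) - 1) := by
    have := fw_fib_sub_one (m + 1)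
    rw [fw_fib_sub_one m, this]
    rcases Nat.mod_two_eq_zero_or_one m with h0 | h0 <;> simp [Nat.add_mod, h0]
  rw [h1, ← h2]
  simp [seg]

/-- The words of the given form are factors of the prefix of length `f_{k+1} - 2`. -/
theorem sliceW_append_sw_append {k i j : ℕ} (hk : 3 ≤ k) (hj : j + 1 < Nat.fib (k + 1))
    (hi : i + 1 < Nat.fib (k + 1)) :
    sliceW (sw k) (j + 2) (Nat.fib (k + 1)) ++ sw (k - 1) ++
      sliceW (sw k) 1 (Nat.fib (k + 1) - i - 1) = seg j (Nat.fib (k + 3) - i - 2 - j) := by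
  obtain ⟨l, rfl⟩ := Nat.exists_eq_add_of_le' hk
  have f1 : Nat.fib (l + 4) = Nat.fib (l + 2) + Nat.fib (l + 3) := Nat.fib_add_two
  have f2 : Nat.fib (l + 5) = Nat.fib (l + 3) + Nat.fib (l + 4) := Nat.fib_add_two
  have f3 : Nat.fib (l + 6) = Nat.fib (l + 4) + Nat.fib (l + 5) := Nat.fib_add_two
  have hpos := Nat.fib_pos.2 (show 0 < l + 2 by omega)
  have hpos' := Nat.fib_pos.2 (show 0 < l + 3 by omega)
  change j + 1 < Nat.fib (l + 4) at hj
  change i + 1 < Nat.fib (l + 4) at hi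
  change sliceW (sw (l + 2 + 1)) (j + 2) (Nat.fib (l + 4)) ++ sw (l + 1 + 1) ++
    sliceW (sw (l + 2 + 1)) 1 (Nat.fib (l + 4) - i - 1) = seg j (Nat.fib (l + 6) - i - 2 - j)
  rw [sliceW_sw_succ (by change j < Nat.fib (l + 4); omega) le_rfl,
    sliceW_sw_succ_one (by omega) (Nat.sub_le_of_le_add
      (by change Nat.fib (l + 4) - i ≤ Nat.fib (l + 4) + 1; omega)), sw_succ_eq,
    not_fw_cons_seg (by omega) (by change Nat.fib (l + 3) - 1 + 2 ≤ Nat.fib (l + 5); omega),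
    not_fw_cons_seg (by omega) (by change Nat.fib (l + 4) - i - 1 - 1 + 2 ≤ Nat.fib (l + 6); omega)]
  change seg j (Nat.fib (l + 4) - 1 - j) ++
    seg (Nat.fib (l + 4) - 1) (Nat.fib (l + 3) - 1 + 1) ++
    seg (Nat.fib (l + 5) - 1) (Nat.fib (l + 4) - i - 1 - 1 + 1) = _
  have e1 : Nat.fib (l + 6) - i - 2 - j = Nat.fib (l + 4) - 1 - j + (Nat.fib (l + 3) - 1 + 1) +
      (Nat.fib (l + 4) - i - 1 - 1 + 1) := by omega
  have e2 : j + (Nat.fib (l + 4) - 1 - j) = Nat.fib (l + 4) - 1 := by omega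
  have e3 : j + (Nat.fib (l + 4) - 1 - j + (Nat.fib (l + 3) - 1 + 1)) = Nat.fib (l + 5) - 1 := by
    omega
  rw [e1, seg_add j, seg_add j, e2, e3]

theorem gap_eq_of_overlap {w : List Bool} {p d : ℕ} (hd : occPos w (p + 1) = occPos w p + d)
    (h : d < w.length) : gap w p = (listToFree (seg (occPos w (p + 1)) (w.length - d)))⁻¹ := by
  rw [gap, if_neg (by omega)]
  congr 3
  omega

/-- let `ω ∈ T2.3` with `n = |ω|`, `f_k < n < f_{k+1}`, `sk(ω) = s_{k-2}` and
`ω = s_{k-1}[f_{k+1}-n-i, f_{k-1}] · s_{k-2} · s_{k-1}[1, f_{k-1}-i-1]` for some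
`0 ≤ i ≤ f_{k+1}-n-2`. Then both gaps are overlaps:
`ν_{ω,1}⁻¹ = s_{k-1}[f_{k+1}-n-i, f_{k-1}-i-1]` with `|ν_{ω,1}| = f_k - n < 0`, and
`ν_{ω,2}⁻¹ = F_k[f_{k+1}-n-i-1, f_k-i-2]` with `|ν_{ω,2}| = f_{k-1} - n < 0`; i.e. every
pair of consecutive occurrences of `ω` overlaps (in a word of length `n - f_k` when the
`p`-th letter of `F_∞` is `a`, of length `n - f_{k-1}` when it is `b`). -/
theorem stmt17 (k i n : ℕ) (ω : List Bool)
    (h1 : Nat.fib (k+2) < n) (h2 : n < Nat.fib (k+3)) (h3 : i + n + 2 ≤ Nat.fib (k+3))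
    (hω : ω = sliceW (sw k) (Nat.fib (k+3) - n - i) (Nat.fib (k+1)) ++ sw (k-1) ++
              sliceW (sw k) 1 (Nat.fib (k+1) - i - 1))
    (hn : ω.length = n) (hfac : IsFactor ω) (hker : IsKernelOf (sw (k-1)) ω) :
    gap ω 0 = (listToFree (sliceW (sw k) (Nat.fib (k+3) - n - i) (Nat.fib (k+1) - i - 1)))⁻¹ ∧
    gap ω 1 = (listToFree (sliceW (Fw k) (Nat.fib (k+3) - n - i - 1) (Nat.fib (k+2) - i - 2)))⁻¹ ∧
    (∀ p : ℕ, fw p = false → occPos ω (p+1) = occPos ω p + Nat.fib (k+2)) ∧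
    (∀ p : ℕ, fw p = true → occPos ω (p+1) = occPos ω p + Nat.fib (k+1)) ∧
    (∀ p : ℕ, occPos ω (p+1) < occPos ω p + n) := by
  have f1 : Nat.fib (k + 3) = Nat.fib (k + 1) + Nat.fib (k + 2) := Nat.fib_add_two
  have f2 : Nat.fib (k + 2) = Nat.fib k + Nat.fib (k + 1) := Nat.fib_add_two
  have hk : 3 ≤ k := by
    by_contra hk
    have : Nat.fib (k + 1) ≤ 2 := Nat.fib_mono (show k + 1 ≤ 3 by omega)
    omega
  obtain ⟨j, hj⟩ : ∃ j, Nat.fib (k + 3) = j + n + i + 2 :=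
    ⟨Nat.fib (k + 3) - n - i - 2, by omega⟩
  have e1 : Nat.fib (k + 3) - n - i = j + 2 := by omega
  have hseg : ω = seg j n := by
    rw [hω, e1, sliceW_append_sw_append hk (by omega) (by omega)]
    congr 1
    omega
  have hpos : ∀ p, occPos ω p = blockPos k p + j := fun p => by
    rw [hseg]
    exact occPos_seg (by omega) h1 (by omega) p
  have hfalse : ∀ p, fw p = false → occPos ω (p + 1) = occPos ω p + Nat.fib (k + 2) :=
    fun p hp => by rw [hpos, hpos, blockPos_succ_of_false hp]; omega
  have htrue : ∀ p, fw p = true → occPos ω (p + 1) = occPos ω p + Nat.fib (k + 1) :=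
    fun p hp => by rw [hpos, hpos, blockPos_succ_of_true hp]; omega
  refine ⟨?_, ?_, hfalse, htrue, fun p => ?_⟩
  · rw [gap_eq_of_overlap (hfalse 0 fw_zero) (by omega), hpos, hn, e1]
    obtain ⟨l, rfl⟩ := Nat.exists_eq_add_of_le' (show 1 ≤ k by omega)
    rw [sliceW_sw_succ (by omega) (by change _ ≤ Nat.fib (l + 1 + 1); omega)]
    have e2 : Nat.fib (l + 1 + 1) - i - 1 - 1 - j = n - Nat.fib (l + 1 + 2) := by omega
    rw [e2]
    congr 2
    refine seg_eq_seg_iff.2 fun t ht => ?_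
    rw [add_assoc, fw_blockPos_add (by omega) (by omega)]
  · rw [gap_eq_of_overlap (htrue 1 fw_one) (by omega), hpos, hn, e1, sliceW, Fw_eq_seg,
      take_seg (by omega), Nat.sub_sub, Nat.add_sub_cancel, drop_seg (by omega), zero_add]
    have e2 : Nat.fib (k + 2) - i - 2 - j = n - Nat.fib (k + 1) := by omega
    rw [e2]
    congr 2
    refine seg_eq_seg_iff.2 fun t ht => ?_
    rw [add_assoc, fw_blockPos_add (by omega) (by omega)]
  · cases hp : fw p
    · rw [hfalse p hp]; omega
    · rw [htrue p hp]; omega
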